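/- For every δ ∈ (0,1), with probability at least 1 − δ over a sample (x_1,…,x_n) drawn i.i.d. from ν (i.e., from ν^{⊗n}), the following holds: for every ĝ ∈ G with R̂_SC(ĝ) ≤ R̂_SC(g) for all g ∈ G (an empirical risk minimizer) and every g* ∈ G, R(ĝ) − R(g*) ≤ (4√2 · π · L_ℓ / C_r) · ∑_{y : Fin K} Rad_n(G_y, ν) + (2π · C_ℓ / C_r) · √(log(2/δ) / (2n)). (Estimation error bound for SC-Conf classification, Theorem 2, with the constant 2πC_ℓ/C_r that the paper's proof yields.) -/

import Mathlib

open MeasureTheory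

/-- Expected Rademacher complexity of a class `F` of real-valued functions on a sample of
size `n` drawn i.i.d. from `ρ`. -/
noncomputable def rademacherComplexity {X : Type*} [MeasurableSpace X] (ρ : Measure X)
    (n : ℕ) (F : Set (X → ℝ)) : ℝ :=
  ∫ xs : Fin n → X,
    (∑ σ : Fin n → Bool,
        sSup ((fun f : X → ℝ => (∑ i, (if σ i then (1 : ℝ) else -1) * f (xs i)) / n) '' F))
      / 2 ^ n
    ∂(Measure.pi fun _ => ρ)

open scoped BigOperators

/-- The sign `±1` encoded by a Boolean. -/
noncomputable def boolSign (b : Bool) : ℝ := if b then 1 else -1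

theorem boolSign_not (b : Bool) : boolSign (!b) = -boolSign b := by
  cases b <;> simp [boolSign]

theorem abs_boolSign (b : Bool) : |boolSign b| = 1 := by
  cases b <;> simp [boolSign]

theorem expect_bool (f : Bool → ℝ) : 𝔼 b, f b = (f true + f false) / 2 := by
  rw [Fintype.expect_eq_sum_div_card]; simp

/-- Averaging over `α ^ (n + 1)` amounts to averaging over the first coordinate and the others. -/
theorem expect_fin_succ {α : Type*} [Fintype α] {n : ℕ} (f : (Fin (n + 1) → α) → ℝ) :
    𝔼 x, f x = 𝔼 a, 𝔼 x : Fin n → α, f (Fin.cons a x) := by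
  rw [← Fintype.expect_equiv (Fin.consEquiv fun _ : Fin (n + 1) => α)
    (fun z => f (Fin.cons z.1 z.2)) f (fun z => rfl)]
  exact Finset.expect_product' _ _ (fun a x => f (Fin.cons a x))

theorem sq_expect_le {α : Type*} [Fintype α] [Nonempty α] (f : α → ℝ) :
    (𝔼 x, f x) ^ 2 ≤ 𝔼 x, f x ^ 2 := by
  have h : 0 ≤ 𝔼 x, (f x - 𝔼 z, f z) ^ 2 :=
    Finset.expect_nonneg fun x _ => sq_nonneg _
  set m := 𝔼 z, f z with hm
  have e : 𝔼 x, (f x - m) ^ 2 = (𝔼 x, f x ^ 2) - 2 * m * (𝔼 x, f x) + m ^ 2 := by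
    rw [Finset.mul_expect, ← Finset.expect_sub_distrib]
    conv_rhs => rw [← Fintype.expect_const (ι := α) (m ^ 2)]
    rw [← Finset.expect_add_distrib]
    exact Finset.expect_congr rfl fun x _ => by ring
  rw [e, ← hm] at h
  nlinarith

section Cube

variable {n : ℕ}

/-- Flip the `i`-th coordinate of a point of the discrete cube. -/
def cubeFlip (i : Fin n) (x : Fin n → Bool) : Fin n → Bool := Function.update x i (!x i)

/-- The antipode of a point of the discrete cube. -/
def cubeNeg (x : Fin n → Bool) : Fin n → Bool := fun i => !x i

theorem cubeFlip_zero_cons (b : Bool) (x : Fin n → Bool) :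
    cubeFlip 0 (Fin.cons b x : Fin (n + 1) → Bool) = Fin.cons (!b) x := by
  simp [cubeFlip]

theorem cubeFlip_succ_cons (i : Fin n) (b : Bool) (x : Fin n → Bool) :
    cubeFlip i.succ (Fin.cons b x : Fin (n + 1) → Bool) = Fin.cons b (cubeFlip i x) := by
  simp [cubeFlip, Fin.cons_update]

theorem cubeNeg_cons (b : Bool) (x : Fin n → Bool) :
    cubeNeg (Fin.cons b x : Fin (n + 1) → Bool) = Fin.cons (!b) (cubeNeg x) := by
  ext i; refine Fin.cases ?_ (fun i => ?_) i <;> simp [cubeNeg]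

theorem cubeNeg_cubeNeg (x : Fin n → Bool) : cubeNeg (cubeNeg x) = x := by
  ext i; simp [cubeNeg]

theorem cubeFlip_cubeFlip (i : Fin n) (x : Fin n → Bool) : cubeFlip i (cubeFlip i x) = x := by
  simp [cubeFlip]

theorem cubeFlip_cubeNeg (i : Fin n) (x : Fin n → Bool) :
    cubeFlip i (cubeNeg x) = cubeNeg (cubeFlip i x) := by
  ext j
  by_cases h : j = i
  · subst h; simp [cubeFlip, cubeNeg]
  · simp [cubeFlip, cubeNeg, h]

theorem expect_comp_cubeNeg (f : (Fin n → Bool) → ℝ) : 𝔼 x, f (cubeNeg x) = 𝔼 x, f x :=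
  Fintype.expect_equiv (Function.Involutive.toPerm _ cubeNeg_cubeNeg) _ _ fun _ => rfl

theorem expect_comp_cubeFlip (i : Fin n) (f : (Fin n → Bool) → ℝ) :
    𝔼 x, f (cubeFlip i x) = 𝔼 x, f x :=
  Fintype.expect_equiv (Function.Involutive.toPerm _ (cubeFlip_cubeFlip i)) _ _ fun _ => rfl

/-- The Dirichlet form of a function on the discrete cube. -/
noncomputable def cubeEnergy (f : (Fin n → Bool) → ℝ) : ℝ :=
  ∑ i, 𝔼 x, (f x - f (cubeFlip i x)) ^ 2

theorem cubeEnergy_succ (f : (Fin (n + 1) → Bool) → ℝ) :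
    cubeEnergy f = (𝔼 x : Fin n → Bool, (f (Fin.cons true x) - f (Fin.cons false x)) ^ 2) +
      (cubeEnergy (fun x : Fin n → Bool => f (Fin.cons true x)) +
        cubeEnergy (fun x : Fin n → Bool => f (Fin.cons false x))) / 2 := by
  simp only [cubeEnergy, Fin.sum_univ_succ, expect_fin_succ, expect_bool, cubeFlip_zero_cons,
    cubeFlip_succ_cons, Bool.not_true, Bool.not_false]
  rw [← Finset.sum_div, Finset.sum_add_distrib]
  simp only [sub_sq_comm (f (Fin.cons false _)) (f (Fin.cons true _))]
  ring

theorem cubeEnergy_comp_cubeNeg (f : (Fin n → Bool) → ℝ) :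
    cubeEnergy (fun x => f (cubeNeg x)) = cubeEnergy f := by
  refine Finset.sum_congr rfl fun i _ => ?_
  rw [← expect_comp_cubeNeg]
  simp only [cubeFlip_cubeNeg, cubeNeg_cubeNeg]

theorem cubeEnergy_parallelogram (f g : (Fin n → Bool) → ℝ) :
    cubeEnergy f + cubeEnergy g =
      2 * (cubeEnergy (fun x => (f x + g x) / 2) + cubeEnergy (fun x => (f x - g x) / 2)) := by
  simp only [cubeEnergy, ← Finset.sum_add_distrib, Finset.mul_sum, ← Finset.expect_add_distrib,
    Finset.mul_expect]
  refine Finset.sum_congr rfl fun i _ => Finset.expect_congr rfl fun x _ => by ring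

/-- The Poincaré inequality on the discrete cube. -/
theorem cube_poincare {n : ℕ} (f : (Fin n → Bool) → ℝ) :
    (𝔼 x, f x ^ 2) - (𝔼 x, f x) ^ 2 ≤ cubeEnergy f / 4 := by
  induction n with
  | zero => simp [cubeEnergy]
  | succ n ih =>
    have ha := ih fun x => f (Fin.cons true x)
    have hb := ih fun x => f (Fin.cons false x)
    have hj := sq_expect_le fun x : Fin n → Bool => f (Fin.cons true x) - f (Fin.cons false x)
    rw [Finset.expect_sub_distrib] at hj
    rw [cubeEnergy_succ]
    simp only [expect_fin_succ, expect_bool] at *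
    nlinarith

/-- A Poincaré inequality on the discrete cube with a correction for the odd part, which doubles
the spectral gap for even functions. -/
theorem cube_poincare_antipodal {n : ℕ} (f : (Fin n → Bool) → ℝ) :
    2 * ((𝔼 x, f x ^ 2) - (𝔼 x, f x) ^ 2) ≤
      cubeEnergy f / 4 + (𝔼 x, (f x - f (cubeNeg x)) ^ 2) / 4 := by
  induction n with
  | zero =>
    simp [cubeEnergy]
    positivity
  | succ n ih =>
    set a : (Fin n → Bool) → ℝ := fun x => f (Fin.cons true x) with ha
    set b : (Fin n → Bool) → ℝ := fun x => f (Fin.cons false (cubeNeg x)) with hb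
    set p : (Fin n → Bool) → ℝ := fun x => (a x + b x) / 2 with hp
    set q : (Fin n → Bool) → ℝ := fun x => (a x - b x) / 2 with hq
    have hbf : ∀ x, f (Fin.cons false x) = b (cubeNeg x) := fun x => by
      simp [hb, cubeNeg_cubeNeg]
    have h1 := ih p
    have h2 := cube_poincare q
    have h3 := sq_expect_le fun x => (q x + q (cubeNeg x)) / 2
    have h4 : 𝔼 x, (q x + q (cubeNeg x)) / 2 = 𝔼 x, q x := by
      rw [← Finset.expect_div, Finset.expect_add_distrib, expect_comp_cubeNeg]; ring
    have e1 : 𝔼 x, f x ^ 2 = (𝔼 x, p x ^ 2) + 𝔼 x, q x ^ 2 := by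
      rw [expect_fin_succ, expect_bool]
      simp only [hbf]
      rw [expect_comp_cubeNeg fun x => b x ^ 2, ← Finset.expect_add_distrib,
        ← Finset.expect_add_distrib, Finset.expect_div]
      exact Finset.expect_congr rfl fun x _ => by simp only [hp, hq, ha]; ring
    have e2 : 𝔼 x, f x = 𝔼 x, p x := by
      rw [expect_fin_succ, expect_bool]
      simp only [hbf]
      rw [expect_comp_cubeNeg b, ← Finset.expect_add_distrib, Finset.expect_div]
    have e3 : cubeEnergy f = (𝔼 x, (a x - b (cubeNeg x)) ^ 2) + (cubeEnergy p + cubeEnergy q) := by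
      rw [cubeEnergy_succ]
      simp only [hbf]
      rw [cubeEnergy_comp_cubeNeg b]
      have := cubeEnergy_parallelogram a b
      simp only [hp, hq]
      linarith
    have e4 : 𝔼 x, (f x - f (cubeNeg x)) ^ 2 = 𝔼 x, (2 * q x) ^ 2 := by
      rw [expect_fin_succ, expect_bool]
      simp only [cubeNeg_cons, Bool.not_true, Bool.not_false, hbf, cubeNeg_cubeNeg]
      rw [← expect_comp_cubeNeg fun x => (b (cubeNeg x) - f (Fin.cons true (cubeNeg x))) ^ 2,
        ← Finset.expect_add_distrib, Finset.expect_div]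
      simp only [cubeNeg_cubeNeg]
      exact Finset.expect_congr rfl fun x _ => by simp only [hq, ha]; ring
    have e5 : 𝔼 x, (a x - b (cubeNeg x)) ^ 2 =
        (𝔼 x, (p x - p (cubeNeg x)) ^ 2) + 𝔼 x, (q x + q (cubeNeg x)) ^ 2 := by
      have : 𝔼 x, (a x - b (cubeNeg x)) ^ 2 =
          ((𝔼 x, (a x - b (cubeNeg x)) ^ 2) + 𝔼 x, (a (cubeNeg x) - b x) ^ 2) / 2 := by
        rw [← expect_comp_cubeNeg fun x => (a (cubeNeg x) - b x) ^ 2]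
        simp only [cubeNeg_cubeNeg]; ring
      rw [this, ← Finset.expect_add_distrib, ← Finset.expect_add_distrib, Finset.expect_div]
      exact Finset.expect_congr rfl fun x _ => by simp only [hp, hq]; ring
    have e6 : 𝔼 x, (2 * q x) ^ 2 = 4 * 𝔼 x, q x ^ 2 := by
      rw [Finset.mul_expect]; exact Finset.expect_congr rfl fun x _ => by ring
    have e7 : 𝔼 x, ((q x + q (cubeNeg x)) / 2) ^ 2 = (𝔼 x, (q x + q (cubeNeg x)) ^ 2) / 4 := by
      rw [Finset.expect_div]; exact Finset.expect_congr rfl fun x _ => by ring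
    rw [h4, e7] at h3
    rw [e1, e2, e3, e4, e5, e6]
    linarith

theorem expect_sq_add_sum_boolSign {n : ℕ} (v : Fin n → ℝ) (c : ℝ) :
    𝔼 x : Fin n → Bool, (c + ∑ i, boolSign (x i) * v i) ^ 2 = c ^ 2 + ∑ i, v i ^ 2 := by
  induction n generalizing c with
  | zero => simp
  | succ n ih =>
    have h := fun c => ih (fun i => v i.succ) c
    rw [expect_fin_succ, expect_bool]
    simp only [Fin.sum_univ_succ, Fin.cons_zero, Fin.cons_succ, ← add_assoc]
    rw [h, h]
    simp [boolSign]
    ring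

/-- Khintchine's inequality between the first and second moments, with the optimal constant. -/
theorem sqrt_sum_sq_le_sqrt_two_mul_expect_abs {n : ℕ} (v : Fin n → ℝ) :
    √(∑ i, v i ^ 2) ≤ √2 * 𝔼 x : Fin n → Bool, |∑ i, boolSign (x i) * v i| := by
  set S : (Fin n → Bool) → ℝ := fun x => ∑ i, boolSign (x i) * v i with hS
  have hneg : ∀ x, S (cubeNeg x) = -S x := fun x => by
    simp [hS, cubeNeg, boolSign_not]
  have hflip : ∀ i x, S (cubeFlip i x) = S x - 2 * (boolSign (x i) * v i) := fun i x => by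
    have h : S x - S (cubeFlip i x) = 2 * (boolSign (x i) * v i) := by
      simp only [hS, ← Finset.sum_sub_distrib]
      rw [Finset.sum_eq_single i]
      · simp [cubeFlip, boolSign_not]; ring
      · intro j _ hj; simp [cubeFlip, hj]
      · simp
    linarith
  have hgap := cube_poincare_antipodal fun x => |S x|
  simp only [hneg, abs_neg, sub_self, sq_abs] at hgap
  have hsum : ∀ x, ((n : ℝ) - 2) * |S x| ≤ ∑ i, |S (cubeFlip i x)| := fun x => by
    refine le_trans ?_ (Finset.abs_sum_le_sum_abs _ _)
    have : ∑ i, S (cubeFlip i x) = ((n : ℝ) - 2) * S x := by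
      simp only [hflip, Finset.sum_sub_distrib, ← Finset.mul_sum]
      simp [hS]; ring
    rw [this, abs_mul]
    exact mul_le_mul_of_nonneg_right (le_abs_self _) (abs_nonneg _)
  have hen : cubeEnergy (fun x => |S x|) ≤ 4 * 𝔼 x, S x ^ 2 := by
    have h1 : ∀ i, 𝔼 x, (|S x| - |S (cubeFlip i x)|) ^ 2 =
        𝔼 x, 2 * (|S x| * (|S x| - |S (cubeFlip i x)|)) := fun i => by
      have h2 := expect_comp_cubeFlip i fun x => S x ^ 2
      have h3 : 𝔼 x, (|S x| - |S (cubeFlip i x)|) ^ 2 =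
          (𝔼 x, 2 * (|S x| * (|S x| - |S (cubeFlip i x)|))) +
            ((𝔼 x, S (cubeFlip i x) ^ 2) - 𝔼 x, S x ^ 2) := by
        rw [← Finset.expect_sub_distrib, ← Finset.expect_add_distrib]
        refine Finset.expect_congr rfl fun x _ => ?_
        rw [← sq_abs (S x), ← sq_abs (S (cubeFlip i x))]; ring
      rw [h3, h2]; ring
    simp only [cubeEnergy, h1]
    rw [← Finset.expect_sum_comm, Finset.mul_expect]
    refine Finset.expect_le_expect fun x _ => ?_
    rw [← Finset.mul_sum, ← Finset.mul_sum, Finset.sum_sub_distrib]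
    simp only [Finset.sum_const, Finset.card_univ, Fintype.card_fin, nsmul_eq_mul]
    have := mul_le_mul_of_nonneg_left (hsum x) (abs_nonneg (S x))
    nlinarith [sq_abs (S x)]
  have hv : 𝔼 x, S x ^ 2 = ∑ i, v i ^ 2 := by
    simpa using expect_sq_add_sum_boolSign v 0
  have h0 : 0 ≤ 𝔼 x, |S x| := Finset.expect_nonneg fun x _ => abs_nonneg _
  have hz : 𝔼 _x : Fin n → Bool, (0 : ℝ) ^ 2 = 0 := by simp
  rw [hz] at hgap
  rw [Real.sqrt_le_left (by positivity), mul_pow, Real.sq_sqrt (by norm_num)]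
  linarith

end Cube

section Contraction

variable {ι : Type*}

theorem bddAbove_range_of_exists_abs_le {f : ι → ℝ} (hf : ∃ C, ∀ s, |f s| ≤ C) :
    BddAbove (Set.range f) := by
  obtain ⟨C, hC⟩ := hf
  exact ⟨C, by rintro _ ⟨s, rfl⟩; exact (abs_le.1 (hC s)).2⟩

theorem exists_abs_add_le {f g : ι → ℝ} (hf : ∃ C, ∀ s, |f s| ≤ C) (hg : ∃ C, ∀ s, |g s| ≤ C) :
    ∃ C, ∀ s, |f s + g s| ≤ C := by
  obtain ⟨C, hC⟩ := hf
  obtain ⟨D, hD⟩ := hg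
  exact ⟨C + D, fun s => (abs_add_le _ _).trans (add_le_add (hC s) (hD s))⟩

theorem exists_abs_const_mul_le {f : ι → ℝ} (c : ℝ) (hf : ∃ C, ∀ s, |f s| ≤ C) :
    ∃ C, ∀ s, |c * f s| ≤ C := by
  obtain ⟨C, hC⟩ := hf
  exact ⟨|c| * C, fun s => by rw [abs_mul]; exact mul_le_mul_of_nonneg_left (hC s) (abs_nonneg c)⟩

theorem exists_abs_sum_le {κ : Type*} [Fintype κ] {f : κ → ι → ℝ}
    (hf : ∀ k, ∃ C, ∀ s, |f k s| ≤ C) : ∃ C, ∀ s, |∑ k, f k s| ≤ C := by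
  choose C hC using hf
  exact ⟨∑ k, C k, fun s =>
    (Finset.abs_sum_le_sum_abs _ _).trans (Finset.sum_le_sum fun k _ => hC k s)⟩

variable [Nonempty ι] {K : ℕ}

/-- Replacing one Rademacher-weighted Lipschitz function of a vector by a Rademacher combination of
the coordinates of that vector. -/
theorem expect_iSup_add_boolSign_mul_le (F h : ι → ℝ) (g : ι → Fin K → ℝ) {L : ℝ} (hL0 : 0 ≤ L)
    (hF : ∃ C, ∀ s, |F s| ≤ C) (hg : ∀ k, ∃ C, ∀ s, |g s k| ≤ C)
    (hL : ∀ s s', |h s - h s'| ≤ L * √(∑ k, (g s k - g s' k) ^ 2)) :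
    𝔼 b, ⨆ s, (F s + boolSign b * h s) ≤
      𝔼 ε : Fin K → Bool, ⨆ s, (F s + √2 * L * ∑ k, boolSign (ε k) * g s k) := by
  set T : (Fin K → Bool) → ℝ := fun ε => ⨆ s, (F s + √2 * L * ∑ k, boolSign (ε k) * g s k) with hT
  have hbdd : ∀ ε : Fin K → Bool,
      BddAbove (Set.range fun s => F s + √2 * L * ∑ k, boolSign (ε k) * g s k) := fun ε =>
    bddAbove_range_of_exists_abs_le <| exists_abs_add_le hF <| exists_abs_const_mul_le _ <|
      exists_abs_sum_le fun k => exists_abs_const_mul_le _ (hg k)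
  have hneg : ∀ (ε : Fin K → Bool) s, ∑ k, boolSign (cubeNeg ε k) * g s k =
      -∑ k, boolSign (ε k) * g s k := fun ε s => by
    simp [cubeNeg, boolSign_not]
  have hpair : ∀ (ε : Fin K → Bool) s s',
      F s + F s' + √2 * L * |∑ k, boolSign (ε k) * (g s k - g s' k)| ≤
        T ε + T (cubeNeg ε) := fun ε s s' => by
    have h1 := le_ciSup (hbdd ε) s
    have h2 := le_ciSup (hbdd ε) s'
    have h3 := le_ciSup (hbdd (cubeNeg ε)) s
    have h4 := le_ciSup (hbdd (cubeNeg ε)) s'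
    simp only [hneg] at h3 h4
    have h5 : T (cubeNeg ε) = ⨆ s, (F s + √2 * L * -∑ k, boolSign (ε k) * g s k) := by
      simp only [hT, hneg]
    rw [h5]
    simp only [mul_sub, Finset.sum_sub_distrib]
    rcases abs_cases (∑ k, boolSign (ε k) * g s k - ∑ k, boolSign (ε k) * g s' k) with h | h <;>
      rw [h.1] <;> simp only [hT] <;> linarith
  have hpair' : ∀ s s', (F s + boolSign true * h s) + (F s' + boolSign false * h s') ≤
      2 * 𝔼 ε, T ε := fun s s' => by
    have h1 : 2 * 𝔼 ε, T ε = 𝔼 ε, (T ε + T (cubeNeg ε)) := by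
      rw [Finset.expect_add_distrib, expect_comp_cubeNeg]; ring
    have h2 := sqrt_sum_sq_le_sqrt_two_mul_expect_abs fun k => g s k - g s' k
    have h3 : F s + F s' +
        √2 * L * 𝔼 ε : Fin K → Bool, |∑ k, boolSign (ε k) * (g s k - g s' k)| ≤
          2 * 𝔼 ε, T ε := by
      rw [h1, Finset.mul_expect,
        ← Fintype.expect_const (ι := Fin K → Bool) (F s + F s'), ← Finset.expect_add_distrib]
      exact Finset.expect_le_expect fun ε _ => hpair ε s s'
    have h4 := mul_le_mul_of_nonneg_left h2 hL0
    have h5 := (le_abs_self _).trans (hL s s')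
    simp only [boolSign, if_true, Bool.false_eq_true, if_false]
    linarith
  rw [expect_bool, div_le_iff₀ (by norm_num), mul_comm]
  have h1 : ∀ s', (⨆ s, (F s + boolSign true * h s)) ≤
      2 * (𝔼 ε, T ε) - (F s' + boolSign false * h s') :=
    fun s' => ciSup_le fun s => by linarith [hpair' s s']
  have h2 : (⨆ s, (F s + boolSign false * h s)) ≤
      2 * (𝔼 ε, T ε) - ⨆ s, (F s + boolSign true * h s) :=
    ciSup_le fun s' => by linarith [h1 s']
  linarith

/-- Maurer's vector contraction inequality, with an arbitrary offset. -/
theorem expect_iSup_add_sum_boolSign_mul_le {n : ℕ} (F : ι → ℝ) (h : Fin n → ι → ℝ)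
    (g : Fin n → ι → Fin K → ℝ) {L : ℝ} (hL0 : 0 ≤ L)
    (hF : ∃ C, ∀ s, |F s| ≤ C) (hh : ∀ i, ∃ C, ∀ s, |h i s| ≤ C)
    (hg : ∀ i k, ∃ C, ∀ s, |g i s k| ≤ C)
    (hL : ∀ i s s', |h i s - h i s'| ≤ L * √(∑ k, (g i s k - g i s' k) ^ 2)) :
    𝔼 σ : Fin n → Bool, ⨆ s, (F s + ∑ i, boolSign (σ i) * h i s) ≤
      𝔼 ε : Fin n → Fin K → Bool,
        ⨆ s, (F s + √2 * L * ∑ i, ∑ k, boolSign (ε i k) * g i s k) := by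
  induction n generalizing F with
  | zero => simp
  | succ n ih =>
    rw [expect_fin_succ, expect_fin_succ (α := Fin K → Bool)]
    simp only [Fin.sum_univ_succ, Fin.cons_zero, Fin.cons_succ, mul_add, ← add_assoc]
    calc _ ≤ 𝔼 b, 𝔼 ε : Fin n → Fin K → Bool, ⨆ s, (F s + boolSign b * h 0 s +
              √2 * L * ∑ i, ∑ k, boolSign (ε i k) * g i.succ s k) :=
          Finset.expect_le_expect fun b _ => ih _ (fun i => h i.succ) (fun i => g i.succ)
            (exists_abs_add_le hF (exists_abs_const_mul_le _ (hh 0))) (fun i => hh i.succ)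
            (fun i => hg i.succ) (fun i => hL i.succ)
      _ = 𝔼 ε : Fin n → Fin K → Bool, 𝔼 b, ⨆ s,
            (F s + √2 * L * (∑ i, ∑ k, boolSign (ε i k) * g i.succ s k) +
              boolSign b * h 0 s) := by
          rw [Finset.expect_comm]
          simp only [add_right_comm]
      _ ≤ 𝔼 ε : Fin n → Fin K → Bool, 𝔼 ε₀ : Fin K → Bool, ⨆ s,
            (F s + √2 * L * (∑ i, ∑ k, boolSign (ε i k) * g i.succ s k) +
              √2 * L * ∑ k, boolSign (ε₀ k) * g 0 s k) :=
          Finset.expect_le_expect fun ε _ => expect_iSup_add_boolSign_mul_le _ (h 0) (g 0) hL0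
            (exists_abs_add_le hF <| exists_abs_const_mul_le _ <| exists_abs_sum_le fun i =>
              exists_abs_sum_le fun k => exists_abs_const_mul_le _ (hg i.succ k)) (hg 0) (hL 0)
      _ = _ := by
          rw [Finset.expect_comm]
          simp only [add_right_comm]

/-- The marginal of the uniform distribution on a power is uniform. -/
theorem expect_comp_eval {α : Type*} [Fintype α] [Nonempty α] (k : Fin K) (f : α → ℝ) :
    𝔼 x : Fin K → α, f (x k) = 𝔼 a, f a := by
  refine (Fintype.expect_equiv (Equiv.funSplitAt k α) _ (fun z => f z.1) fun x => rfl).trans ?_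
  refine (Finset.expect_product' Finset.univ Finset.univ fun a _ => f a).trans ?_
  simp only [Fintype.expect_const]

/-- Vector contraction, with the right-hand side split into coordinates. -/
theorem expect_iSup_sum_boolSign_mul_le {n : ℕ} (h : Fin n → ι → ℝ)
    (g : Fin n → ι → Fin K → ℝ) {L : ℝ} (hL0 : 0 ≤ L)
    (hh : ∀ i, ∃ C, ∀ s, |h i s| ≤ C) (hg : ∀ i k, ∃ C, ∀ s, |g i s k| ≤ C)
    (hL : ∀ i s s', |h i s - h i s'| ≤ L * √(∑ k, (g i s k - g i s' k) ^ 2)) :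
    𝔼 σ : Fin n → Bool, ⨆ s, ∑ i, boolSign (σ i) * h i s ≤
      √2 * L * ∑ k, 𝔼 σ : Fin n → Bool, ⨆ s, ∑ i, boolSign (σ i) * g i s k := by
  have h1 := expect_iSup_add_sum_boolSign_mul_le (fun _ => 0) h g hL0 ⟨0, by simp⟩ hh hg hL
  simp only [zero_add] at h1
  refine h1.trans ?_
  have h2 : ∀ k, 𝔼 σ : Fin n → Bool, ⨆ s, ∑ i, boolSign (σ i) * g i s k =
      𝔼 ε : Fin n → Fin K → Bool, ⨆ s, ∑ i, boolSign (ε i k) * g i s k := fun k => by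
    rw [← expect_comp_eval k]
    exact Fintype.expect_equiv (Equiv.piComm fun _ _ => Bool) _ _ fun _ => rfl
  simp only [h2]
  rw [← Finset.expect_sum_comm, Finset.mul_expect]
  refine Finset.expect_le_expect fun ε _ => ?_
  rw [← Real.mul_iSup_of_nonneg (by positivity)]
  refine mul_le_mul_of_nonneg_left (ciSup_le fun s => ?_) (by positivity)
  rw [Finset.sum_comm]
  refine Finset.sum_le_sum fun k _ => le_ciSup (f := fun s => ∑ i, boolSign (ε i k) * g i s k) ?_ s
  exact bddAbove_range_of_exists_abs_le <| exists_abs_sum_le fun i =>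
    exists_abs_const_mul_le _ (hg i k)

end Contraction

section BoundedDifferences

open ProbabilityTheory

variable {X : Type*} [MeasurableSpace X] (ν : Measure X) [IsProbabilityMeasure ν]

theorem integral_pi_fin_succ {n : ℕ} {f : (Fin (n + 1) → X) → ℝ} (hf : Measurable f) {C : ℝ}
    (hC : ∀ xs, |f xs| ≤ C) :
    ∫ xs, f xs ∂(Measure.pi fun _ : Fin (n + 1) => ν) =
      ∫ x, ∫ xs, f (Fin.cons x xs) ∂(Measure.pi fun _ : Fin n => ν) ∂ν := by
  have hmp := (measurePreserving_piFinSuccAbove (fun _ : Fin (n + 1) => ν) 0).symm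
  have hm : Measurable fun z : X × (Fin n → X) => f (Fin.cons z.1 z.2) := by
    convert hf.comp hmp.measurable using 1
    ext z
    simp [MeasurableEquiv.piFinSuccAbove_symm_apply, Fin.insertNthEquiv]
  rw [← hmp.integral_comp']
  simp only [MeasurableEquiv.piFinSuccAbove_symm_apply, Fin.insertNthEquiv, Equiv.coe_fn_mk,
    Fin.insertNth_zero, Fin.zero_succAbove, cast_eq]
  exact integral_prod (fun z : X × (Fin n → X) => f (Fin.cons z.1 z.2))
    (Integrable.of_bound hm.aestronglyMeasurable C (ae_of_all _ fun z => hC _))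

theorem measurable_fin_cons {n : ℕ} :
    Measurable fun z : X × (Fin n → X) => (Fin.cons z.1 z.2 : Fin (n + 1) → X) := by
  refine measurable_pi_lambda _ fun i => ?_
  refine Fin.cases ?_ (fun i => ?_) i
  · simpa using measurable_fst
  · simpa [Function.comp_def] using (measurable_pi_apply i).comp measurable_snd

/-- **McDiarmid's inequality**: a function with bounded differences of i.i.d. variables is
sub-Gaussian. -/
theorem hasSubgaussianMGF_of_bounded_differences {n : ℕ} {f : (Fin n → X) → ℝ}
    (hf : Measurable f) {C : ℝ} (hC : ∀ xs, |f xs| ≤ C) (c : NNReal)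
    (hc : ∀ xs i x, |f xs - f (Function.update xs i x)| ≤ c) :
    HasSubgaussianMGF (fun xs => f xs - ∫ z, f z ∂(Measure.pi fun _ : Fin n => ν))
      (n * (c / 2) ^ 2) (Measure.pi fun _ : Fin n => ν) := by
  have hbound : ∀ {m : ℕ} {φ : (Fin m → X) → ℝ} {D : ℝ}, (∀ xs, |φ xs| ≤ D) →
      ∀ t a xs : _, |Real.exp (t * (φ xs - a))| ≤ Real.exp (|t| * (D + |a|)) :=
    fun {m φ D} hD t a xs => by
      rw [Real.abs_exp, Real.exp_le_exp]
      refine (le_abs_self _).trans ?_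
      rw [abs_mul]
      exact mul_le_mul_of_nonneg_left ((abs_sub _ _).trans (by linarith [hD xs])) (abs_nonneg _)
  have hexpm : ∀ {m : ℕ} {φ : (Fin m → X) → ℝ}, Measurable φ → ∀ t a : ℝ,
      Measurable fun xs => Real.exp (t * (φ xs - a)) := fun hφ t a =>
    Real.measurable_exp.comp ((hφ.sub_const a).const_mul t)
  refine ⟨fun t => Integrable.of_bound (hexpm hf t _).aestronglyMeasurable _
    (ae_of_all _ (hbound hC t _)), fun t => ?_⟩
  unfold mgf
  induction n with
  | zero =>
    have h : ∀ x, f x = f default := fun x => congrArg f (Subsingleton.elim _ _)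
    simp [h]
  | succ n ih =>
    set P := Measure.pi fun _ : Fin n => ν
    set h : X → ℝ := fun x => ∫ xs, f (Fin.cons x xs) ∂P with hh
    have hfx : ∀ x, Measurable fun xs : Fin n → X => f (Fin.cons x xs) := fun x =>
      hf.comp (measurable_fin_cons.comp measurable_prodMk_left)
    have hint : ∀ x, Integrable (fun xs : Fin n → X => f (Fin.cons x xs)) P := fun x =>
      Integrable.of_bound (hfx x).aestronglyMeasurable C (ae_of_all _ fun xs => hC _)
    have hhm : Measurable h :=
      ((hf.comp measurable_fin_cons).stronglyMeasurable.integral_prod_right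
        (f := fun x xs => f (Fin.cons x xs))).measurable
    have hhc : ∀ x x', h x ≤ h x' + c := fun x x' => by
      have : h x' + c = ∫ xs, (f (Fin.cons x' xs) + c) ∂P := by
        rw [integral_add (hint x') (integrable_const _)]; simp [hh]
      rw [this]
      refine integral_mono (hint x) ((hint x').add (integrable_const _)) fun xs => ?_
      have := (le_abs_self _).trans (hc (Fin.cons x xs) 0 x')
      rw [Fin.update_cons_zero] at this
      simp only
      linarith
    have hhC : ∀ x, |h x| ≤ C := fun x => by
      have := norm_integral_le_of_norm_le_const (μ := P)
        (f := fun xs => f (Fin.cons x xs)) (ae_of_all _ fun xs => hC _)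
      simpa using this
    have hE : ∫ z, f z ∂(Measure.pi fun _ : Fin (n + 1) => ν) = ∫ x, h x ∂ν :=
      integral_pi_fin_succ ν hf hC
    rw [hE, integral_pi_fin_succ ν (hexpm hf t _) (hbound hC t _)]
    have hinner : ∀ x, ∫ xs, Real.exp (t * (f (Fin.cons x xs) - ∫ x, h x ∂ν)) ∂P ≤
        Real.exp ((n * (c / 2) ^ 2 : NNReal) * t ^ 2 / 2) *
          Real.exp (t * (h x - ∫ x, h x ∂ν)) := fun x => by
      have e : ∀ xs, Real.exp (t * (f (Fin.cons x xs) - ∫ x, h x ∂ν)) =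
          Real.exp (t * (f (Fin.cons x xs) - h x)) * Real.exp (t * (h x - ∫ x, h x ∂ν)) :=
        fun xs => by rw [← Real.exp_add]; ring_nf
      simp only [e]
      rw [integral_mul_const]
      refine mul_le_mul_of_nonneg_right ?_ (Real.exp_pos _).le
      refine ih (hfx x) (fun xs => hC _) fun xs i x' => ?_
      rw [Fin.cons_update]
      exact hc _ _ _
    obtain ⟨x₀⟩ : Nonempty X := nonempty_of_isProbabilityMeasure ν
    have hbdd : BddBelow (Set.range h) :=
      ⟨-C, by rintro _ ⟨x, rfl⟩; exact (abs_le.1 (hhC x)).1⟩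
    have hne : Nonempty X := ⟨x₀⟩
    have hIcc : ∀ x, h x ∈ Set.Icc (⨅ x, h x) ((⨅ x, h x) + c) := fun x =>
      ⟨ciInf_le hbdd x, by
        have : h x - c ≤ ⨅ x, h x := le_ciInf fun x' => by linarith [hhc x x']
        linarith⟩
    have hoeff := hasSubgaussianMGF_of_mem_Icc (μ := ν) hhm.aemeasurable (ae_of_all _ hIcc)
    have hmgf := hoeff.mgf_le t
    have hintg := hoeff.integrable_exp_mul t
    unfold mgf at hmgf
    have hcc : ((‖(⨅ x, h x) + (c : ℝ) - ⨅ x, h x‖₊ / 2) ^ 2 : NNReal) = (c / 2) ^ 2 := by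
      congr 2
      ext
      simp
    rw [hcc] at hmgf
    refine (integral_mono_of_nonneg
      (ae_of_all _ fun x => integral_nonneg fun xs => (Real.exp_pos _).le)
      (hintg.const_mul _) (ae_of_all _ hinner)).trans ?_
    rw [integral_const_mul]
    refine (mul_le_mul_of_nonneg_left hmgf (Real.exp_pos _).le).trans ?_
    rw [← Real.exp_add, Real.exp_le_exp]
    push_cast
    apply le_of_eq
    ring

end BoundedDifferences

section Symmetrization

open ProbabilityTheory

variable {Z ι : Type*} [MeasurableSpace Z] [Nonempty ι]

theorem abs_iSup_le_of_forall_abs_le {f : ι → ℝ} {C : ℝ} (hC : ∀ k, |f k| ≤ C) :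
    |⨆ k, f k| ≤ C := by
  obtain ⟨k⟩ := ‹Nonempty ι›
  refine abs_le.2 ⟨?_, ciSup_le fun k => (abs_le.1 (hC k)).2⟩
  exact (abs_le.1 (hC k)).1.trans (le_ciSup (bddAbove_range_of_exists_abs_le ⟨C, hC⟩) k)

theorem integrable_iSup_of_abs_le [Countable ι] (P : Measure Z) [IsFiniteMeasure P]
    {ψ : ι → Z → ℝ} (hψ : ∀ k, Measurable (ψ k)) {C : ℝ} (hC : ∀ k z, |ψ k z| ≤ C) :
    Integrable (fun z => ⨆ k, ψ k z) P :=
  Integrable.of_bound (Measurable.iSup hψ).aestronglyMeasurable C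
    (ae_of_all _ fun z => abs_iSup_le_of_forall_abs_le fun k => hC k z)

theorem abs_sum_fin_le {n : ℕ} {a : Fin n → ℝ} {B : ℝ} (ha : ∀ i, |a i| ≤ B) :
    |∑ i, a i| ≤ n * B := by
  refine (Finset.abs_sum_le_sum_abs _ _).trans ?_
  simpa using Finset.sum_le_card_nsmul Finset.univ (fun i => |a i|) B fun i _ => ha i

theorem integral_comp_of_measurePreserving {W : Type*} [MeasurableSpace W]
    {P : Measure Z} {Q : Measure W} {T : Z → W} (hT : MeasurePreserving T P Q) {φ : W → ℝ}
    (hφ : Measurable φ) : ∫ z, φ (T z) ∂P = ∫ w, φ w ∂Q := by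
  rw [← hT.map_eq, integral_map hT.measurable.aemeasurable hφ.aestronglyMeasurable]

variable {X : Type*} [MeasurableSpace X] (ν : Measure X) [IsProbabilityMeasure ν]
  [Countable ι] {n : ℕ}

/-- **Symmetrization**: the expected supremum of a centred empirical process is at most twice
the Rademacher average. -/
theorem integral_iSup_sum_sub_integral_le {d : ι → X → ℝ} (hd : ∀ k, Measurable (d k)) {B : ℝ}
    (hB : ∀ k x, |d k x| ≤ B) :
    ∫ xs, ⨆ k, ∑ i, (d k (xs i) - ∫ x, d k x ∂ν) ∂(Measure.pi fun _ : Fin n => ν) ≤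
      2 * 𝔼 σ : Fin n → Bool,
        ∫ xs, ⨆ k, ∑ i, boolSign (σ i) * d k (xs i) ∂(Measure.pi fun _ : Fin n => ν) := by
  set P := Measure.pi fun _ : Fin n => ν
  set Q := Measure.pi fun _ : Fin n => ν.prod ν
  have hdI : ∀ k, |∫ x, d k x ∂ν| ≤ B := fun k => by
    simpa using norm_integral_le_of_norm_le_const (μ := ν) (f := d k) (ae_of_all _ (hB k))
  have hdm : ∀ k i, Measurable fun xs : Fin n → X => d k (xs i) := fun k i =>
    (hd k).comp (measurable_pi_apply i)
  have hsign : ∀ b a, |a| ≤ B → |boolSign b * a| ≤ B := fun b a ha => by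
    rwa [abs_mul, abs_boolSign, one_mul]
  have habs : ∀ k x y, |d k x - d k y| ≤ B + B := fun k x y =>
    (abs_sub _ _).trans (add_le_add (hB k x) (hB k y))
  have hUint : Integrable (fun z : (Fin n → X) × (Fin n → X) =>
      ⨆ k, ∑ i, (d k (z.1 i) - d k (z.2 i))) (P.prod P) :=
    integrable_iSup_of_abs_le _ (fun k => Finset.measurable_fun_sum _ fun i _ =>
      ((hdm k i).comp measurable_fst).sub ((hdm k i).comp measurable_snd))
      fun k z => abs_sum_fin_le fun i => habs k _ _
  have hghost : ∀ xs : Fin n → X, ⨆ k, ∑ i, (d k (xs i) - ∫ x, d k x ∂ν) ≤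
      ∫ ys, ⨆ k, ∑ i, (d k (xs i) - d k (ys i)) ∂P := fun xs => by
    refine ciSup_le fun k => ?_
    have hi : ∀ i, Integrable (fun ys : Fin n → X => d k (xs i) - d k (ys i)) P := fun i =>
      Integrable.of_bound (measurable_const.sub (hdm k i)).aestronglyMeasurable (B + B)
        (ae_of_all _ fun ys => habs k _ _)
    have e : ∑ i, (d k (xs i) - ∫ x, d k x ∂ν) = ∫ ys, ∑ i, (d k (xs i) - d k (ys i)) ∂P := by
      rw [integral_finsetSum _ fun i _ => hi i]
      refine Finset.sum_congr rfl fun i _ => ?_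
      rw [integral_sub (integrable_const _) (Integrable.of_bound (hdm k i).aestronglyMeasurable B
          (ae_of_all _ fun ys => hB k _)),
        integral_comp_of_measurePreserving
          (measurePreserving_eval (fun _ : Fin n => ν) i) (hd k)]
      simp
    rw [e]
    refine integral_mono (integrable_finsetSum _ fun i _ => hi i)
      (integrable_iSup_of_abs_le P (fun k => Finset.measurable_fun_sum _ fun i _ =>
        measurable_const.sub (hdm k i)) fun k ys => abs_sum_fin_le fun i => habs k _ _)
      fun ys => ?_
    exact le_ciSup (f := fun k => ∑ i, (d k (xs i) - d k (ys i)))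
      (bddAbove_range_of_exists_abs_le ⟨_, fun k => abs_sum_fin_le fun i => habs k _ _⟩) k
  have hzm : ∀ k i, Measurable fun z : Fin n → X × X => d k (z i).1 := fun k i =>
    (hd k).comp (measurable_fst.comp (measurable_pi_apply i))
  have hzm' : ∀ k i, Measurable fun z : Fin n → X × X => d k (z i).2 := fun k i =>
    (hd k).comp (measurable_snd.comp (measurable_pi_apply i))
  have hdouble : ∫ xs, ⨆ k, ∑ i, (d k (xs i) - ∫ x, d k x ∂ν) ∂P ≤
      ∫ z, ⨆ k, ∑ i, (d k (z i).1 - d k (z i).2) ∂Q := by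
    have e : ∫ z, ⨆ k, ∑ i, (d k (z i).1 - d k (z i).2) ∂Q =
        ∫ z : (Fin n → X) × (Fin n → X), ⨆ k, ∑ i, (d k (z.1 i) - d k (z.2 i)) ∂(P.prod P) :=
      (measurePreserving_arrowProdEquivProdArrow X X (Fin n) (fun _ => ν)
        (fun _ => ν)).integral_comp' (g := fun z : (Fin n → X) × (Fin n → X) =>
          ⨆ k, ∑ i, (d k (z.1 i) - d k (z.2 i)))
    rw [e, integral_prod _ hUint]
    exact integral_mono
      (integrable_iSup_of_abs_le P (fun k => Finset.measurable_fun_sum _ fun i _ =>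
        (hdm k i).sub measurable_const) fun k xs => abs_sum_fin_le fun i =>
          (abs_sub _ _).trans (add_le_add (hB k _) (hdI k)))
      hUint.integral_prod_left hghost
  have hRint : ∀ σ : Fin n → Bool,
      Measurable fun xs : Fin n → X => ⨆ k, ∑ i, boolSign (σ i) * d k (xs i) := fun σ =>
    Measurable.iSup fun k => Finset.measurable_fun_sum _ fun i _ => (hdm k i).const_mul _
  have hswap : ∀ σ : Fin n → Bool, ∫ z, ⨆ k, ∑ i, (d k (z i).1 - d k (z i).2) ∂Q ≤
      (∫ xs, ⨆ k, ∑ i, boolSign (σ i) * d k (xs i) ∂P) +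
        ∫ xs, ⨆ k, ∑ i, boolSign (cubeNeg σ i) * d k (xs i) ∂P := fun σ => by
    have hT : MeasurePreserving
        (fun (z : Fin n → X × X) i => (if σ i then id else Prod.swap) (z i)) Q Q :=
      measurePreserving_pi _ _ fun i => by
        cases σ i
        · simpa using Measure.measurePreserving_swap
        · simpa using MeasurePreserving.id _
    have hfst : MeasurePreserving (fun (z : Fin n → X × X) i => (z i).1) Q P :=
      measurePreserving_pi _ _ fun i => measurePreserving_fst
    have hsnd : MeasurePreserving (fun (z : Fin n → X × X) i => (z i).2) Q P :=
      measurePreserving_pi _ _ fun i => measurePreserving_snd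
    rw [← integral_comp_of_measurePreserving hT
        (φ := fun z => ⨆ k, ∑ i, (d k (z i).1 - d k (z i).2))
        (Measurable.iSup fun k => Finset.measurable_fun_sum _ fun i _ =>
          (hzm k i).sub (hzm' k i)),
      ← integral_comp_of_measurePreserving hfst (hRint σ),
      ← integral_comp_of_measurePreserving hsnd (hRint (cubeNeg σ))]
    have e : ∀ (z : Fin n → X × X) k i, d k ((if σ i then id else Prod.swap) (z i)).1 -
        d k ((if σ i then id else Prod.swap) (z i)).2 =
          boolSign (σ i) * d k (z i).1 + boolSign (cubeNeg σ i) * d k (z i).2 := fun z k i => by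
      cases h : σ i <;> simp [boolSign, cubeNeg, h] <;> ring
    simp only [e]
    have h1 : ∀ σ : Fin n → Bool, Integrable (fun z : Fin n → X × X =>
        ⨆ k, ∑ i, boolSign (σ i) * d k (z i).1) Q := fun σ =>
      integrable_iSup_of_abs_le Q (fun k => Finset.measurable_fun_sum _ fun i _ =>
        (hzm k i).const_mul _) fun k z => abs_sum_fin_le fun i => hsign _ _ (hB k _)
    have h2 : ∀ σ : Fin n → Bool, Integrable (fun z : Fin n → X × X =>
        ⨆ k, ∑ i, boolSign (σ i) * d k (z i).2) Q := fun σ =>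
      integrable_iSup_of_abs_le Q (fun k => Finset.measurable_fun_sum _ fun i _ =>
        (hzm' k i).const_mul _) fun k z => abs_sum_fin_le fun i => hsign _ _ (hB k _)
    rw [← integral_add (h1 σ) (h2 _)]
    refine integral_mono (integrable_iSup_of_abs_le Q (fun k => Finset.measurable_fun_sum _
      fun i _ => ((hzm k i).const_mul _).add ((hzm' k i).const_mul _)) fun k z =>
        abs_sum_fin_le fun i => (abs_add_le _ _).trans
          (add_le_add (hsign _ _ (hB k _)) (hsign _ _ (hB k _)))) ((h1 σ).add (h2 _)) fun z => ?_
    refine ciSup_le fun k => ?_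
    rw [Finset.sum_add_distrib]
    exact add_le_add
      (le_ciSup (f := fun k => ∑ i, boolSign (σ i) * d k (z i).1)
        (bddAbove_range_of_exists_abs_le
          ⟨_, fun k => abs_sum_fin_le fun i => hsign _ _ (hB k _)⟩) k)
      (le_ciSup (f := fun k => ∑ i, boolSign (cubeNeg σ i) * d k (z i).2)
        (bddAbove_range_of_exists_abs_le
          ⟨_, fun k => abs_sum_fin_le fun i => hsign _ _ (hB k _)⟩) k)
  refine hdouble.trans ?_
  rw [← Fintype.expect_const (ι := Fin n → Bool)
    (∫ z, ⨆ k, ∑ i, (d k (z i).1 - d k (z i).2) ∂Q)]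
  refine (Finset.expect_le_expect fun σ _ => hswap σ).trans (le_of_eq ?_)
  rw [Finset.expect_add_distrib,
    expect_comp_cubeNeg fun σ => ∫ xs, ⨆ k, ∑ i, boolSign (σ i) * d k (xs i) ∂P]
  ring

/-- The Rademacher average of the differences of a class is at most twice that of the class. -/
theorem expect_integral_iSup_sub_le {f : ι → X → ℝ} (hf : ∀ k, Measurable (f k)) {B : ℝ}
    (hB : ∀ k x, |f k x| ≤ B) :
    𝔼 σ : Fin n → Bool, ∫ xs, ⨆ p : ι × ι, ∑ i, boolSign (σ i) * (f p.2 (xs i) - f p.1 (xs i))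
        ∂(Measure.pi fun _ : Fin n => ν) ≤
      2 * 𝔼 σ : Fin n → Bool,
        ∫ xs, ⨆ k, ∑ i, boolSign (σ i) * f k (xs i) ∂(Measure.pi fun _ : Fin n => ν) := by
  set P := Measure.pi fun _ : Fin n => ν
  have hm : ∀ k i, Measurable fun xs : Fin n → X => f k (xs i) := fun k i =>
    (hf k).comp (measurable_pi_apply i)
  have hsign : ∀ {D : ℝ} (b a), |a| ≤ D → |boolSign b * a| ≤ D := fun b a ha => by
    rwa [abs_mul, abs_boolSign, one_mul]
  have hint : ∀ σ : Fin n → Bool,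
      Integrable (fun xs : Fin n → X => ⨆ k, ∑ i, boolSign (σ i) * f k (xs i)) P := fun σ =>
    integrable_iSup_of_abs_le P (fun k => Finset.measurable_fun_sum _ fun i _ =>
      (hm k i).const_mul _) fun k z => abs_sum_fin_le fun i => hsign _ _ (hB k _)
  have hbdd : ∀ (σ : Fin n → Bool) (xs : Fin n → X),
      BddAbove (Set.range fun k => ∑ i, boolSign (σ i) * f k (xs i)) := fun σ xs =>
    bddAbove_range_of_exists_abs_le ⟨_, fun k => abs_sum_fin_le fun i => hsign _ _ (hB k _)⟩
  have hsplit : ∀ σ : Fin n → Bool,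
      ∫ xs, ⨆ p : ι × ι, ∑ i, boolSign (σ i) * (f p.2 (xs i) - f p.1 (xs i)) ∂P ≤
        (∫ xs, ⨆ k, ∑ i, boolSign (σ i) * f k (xs i) ∂P) +
          ∫ xs, ⨆ k, ∑ i, boolSign (cubeNeg σ i) * f k (xs i) ∂P := fun σ => by
    rw [← integral_add (hint σ) (hint _)]
    refine integral_mono (integrable_iSup_of_abs_le P (fun p => Finset.measurable_fun_sum _
      fun i _ => ((hm p.2 i).sub (hm p.1 i)).const_mul _) fun p xs =>
        abs_sum_fin_le fun i => hsign _ _ ((abs_sub _ _).trans (add_le_add (hB _ _) (hB _ _))))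
      ((hint σ).add (hint _)) fun xs => ?_
    refine ciSup_le fun p => ?_
    have h1 := le_ciSup (hbdd σ xs) p.2
    have h2 := le_ciSup (hbdd (cubeNeg σ) xs) p.1
    have e : ∑ i, boolSign (σ i) * (f p.2 (xs i) - f p.1 (xs i)) =
        (∑ i, boolSign (σ i) * f p.2 (xs i)) + ∑ i, boolSign (cubeNeg σ i) * f p.1 (xs i) := by
      rw [← Finset.sum_add_distrib]
      refine Finset.sum_congr rfl fun i _ => ?_
      rw [cubeNeg, boolSign_not]; ring
    rw [e]
    exact add_le_add h1 h2
  refine (Finset.expect_le_expect fun σ _ => hsplit σ).trans (le_of_eq ?_)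
  rw [Finset.expect_add_distrib,
    expect_comp_cubeNeg fun σ => ∫ xs, ⨆ k, ∑ i, boolSign (σ i) * f k (xs i) ∂P]
  ring

end Symmetrization

/-- The Rademacher complexity of an indexed family, as an average of integrals over signs. -/
theorem rademacherComplexity_image_eq {X Y : Type*} [MeasurableSpace X] (ν : Measure X)
    {n : ℕ} {G : Set Y} (a : Y → X → ℝ) :
    rademacherComplexity ν n (a '' G) =
      (∫ xs, 𝔼 σ : Fin n → Bool, ⨆ g : G, ∑ i, boolSign (σ i) * a g (xs i)
        ∂(Measure.pi fun _ : Fin n => ν)) / n := by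
  unfold rademacherComplexity
  rw [← integral_div]
  congr 1
  ext xs
  have hc : (Fintype.card (Fin n → Bool) : ℝ) = 2 ^ n := by simp
  rw [Fintype.expect_eq_sum_div_card, hc, div_right_comm]
  refine congrArg (· / (2 : ℝ) ^ n) ?_
  rw [Finset.sum_div]
  refine Finset.sum_congr rfl fun σ _ => ?_
  rw [Set.image_image, sSup_image', div_eq_mul_inv (⨆ _ : G, _), Real.iSup_mul_of_nonneg (by positivity)]
  simp only [boolSign, div_eq_mul_inv]

section UniformDeviation

open ProbabilityTheory

variable {X ι : Type*} [MeasurableSpace X] [Nonempty ι] [Countable ι]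
  (ν : Measure X) [IsProbabilityMeasure ν] {n : ℕ}

/-- Estimation error of empirical minimizers over a class of functions with values in `[0, B]`. -/
theorem le_measure_integral_sub_integral_le {f : ι → X → ℝ} (hf : ∀ k, Measurable (f k)) {B : ℝ}
    (hf0 : ∀ k x, 0 ≤ f k x) (hfB : ∀ k x, f k x ≤ B) (hn : 1 ≤ n) {δ : ℝ}
    (hδ : δ ∈ Set.Ioo (0 : ℝ) 1) :
    ENNReal.ofReal (1 - δ) ≤
      (Measure.pi fun _ : Fin n => ν)
        {xs | ∀ k l, ∑ i, f k (xs i) ≤ ∑ i, f l (xs i) →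
          ∫ x, f k x ∂ν - ∫ x, f l x ∂ν ≤
            4 * (𝔼 σ : Fin n → Bool, ∫ xs, ⨆ k, ∑ i, boolSign (σ i) * f k (xs i)
              ∂(Measure.pi fun _ : Fin n => ν)) / n +
            2 * B * √(Real.log (2 / δ) / (2 * n))} := by
  set P := Measure.pi fun _ : Fin n => ν
  obtain ⟨x₀⟩ : Nonempty X := nonempty_of_isProbabilityMeasure ν
  obtain ⟨k₀⟩ := ‹Nonempty ι›
  have hne : Nonempty ι := ⟨k₀⟩
  have hB0 : 0 ≤ B := (hf0 k₀ x₀).trans (hfB k₀ x₀)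
  have hn0 : (0 : ℝ) < n := by exact_mod_cast hn
  have hfi : ∀ k, Integrable (f k) ν := fun k =>
    Integrable.of_bound (hf k).aestronglyMeasurable B
      (ae_of_all _ fun x => by rw [Real.norm_of_nonneg (hf0 k x)]; exact hfB k x)
  set d : ι × ι → X → ℝ := fun p x => f p.2 x - f p.1 x with hd
  have hdm : ∀ p, Measurable (d p) := fun p => (hf p.2).sub (hf p.1)
  have hdB : ∀ p x, |d p x| ≤ B := fun p x =>
    abs_le.2 ⟨by simp only [hd]; linarith [hf0 p.2 x, hfB p.1 x],
      by simp only [hd]; linarith [hf0 p.1 x, hfB p.2 x]⟩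
  have hdI : ∀ p, |∫ x, d p x ∂ν| ≤ B := fun p => by
    simpa using norm_integral_le_of_norm_le_const (μ := ν) (f := d p) (ae_of_all _ (hdB p))
  set Ψ : (Fin n → X) → ℝ := fun xs => ⨆ p, ∑ i, (d p (xs i) - ∫ x, d p x ∂ν) with hΨ
  have hΨm : Measurable Ψ := Measurable.iSup fun p => Finset.measurable_fun_sum _ fun i _ =>
    ((hdm p).comp (measurable_pi_apply i)).sub_const _
  have hterm : ∀ (xs : Fin n → X) p, |∑ i, (d p (xs i) - ∫ x, d p x ∂ν)| ≤ n * (B + B) :=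
    fun xs p => abs_sum_fin_le fun i => (abs_sub _ _).trans (add_le_add (hdB _ _) (hdI p))
  have hbdd : ∀ xs : Fin n → X,
      BddAbove (Set.range fun p => ∑ i, (d p (xs i) - ∫ x, d p x ∂ν)) := fun xs =>
    bddAbove_range_of_exists_abs_le ⟨_, hterm xs⟩
  have hone : ∀ xs i x, Ψ xs ≤ Ψ (Function.update xs i x) + 2 * B := fun xs i x => by
    refine ciSup_le fun p => ?_
    have h1 := le_ciSup (hbdd (Function.update xs i x)) p
    have h2 : ∑ j, (d p (xs j) - ∫ x, d p x ∂ν) -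
        ∑ j, (d p (Function.update xs i x j) - ∫ x, d p x ∂ν) = d p (xs i) - d p x := by
      rw [← Finset.sum_sub_distrib, Finset.sum_eq_single i]
      · simp
      · intro j _ hj; simp [hj]
      · simp
    have h3 := (le_abs_self _).trans ((abs_sub _ _).trans (add_le_add (hdB p (xs i)) (hdB p x)))
    simp only [hΨ]
    linarith
  have hdiff : ∀ xs i x, |Ψ xs - Ψ (Function.update xs i x)| ≤ (2 * B).toNNReal := fun xs i x => by
    rw [Real.coe_toNNReal _ (by positivity)]
    have h1 := hone xs i x
    have h2 := hone (Function.update xs i x) i (xs i)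
    rw [Function.update_idem, Function.update_eq_self] at h2
    exact abs_le.2 ⟨by linarith, by linarith⟩
  have hsub := hasSubgaussianMGF_of_bounded_differences ν hΨm
    (fun xs => abs_iSup_le_of_forall_abs_le (hterm xs)) _ hdiff
  set A := 𝔼 σ : Fin n → Bool, ∫ xs, ⨆ k, ∑ i, boolSign (σ i) * f k (xs i) ∂P
  have hmean : ∫ xs, Ψ xs ∂P ≤ 4 * A := by
    refine (integral_iSup_sum_sub_integral_le ν hdm hdB).trans ?_
    have := expect_integral_iSup_sub_le ν (n := n) hf
      (fun k x => by rw [abs_of_nonneg (hf0 k x)]; exact hfB k x)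
    simp only [hd]
    linarith
  set ε := 2 * B * √(Real.log (2 / δ) / (2 * n)) with hε
  have hlog : 0 < Real.log (2 / δ) :=
    Real.log_pos (by rw [lt_div_iff₀ hδ.1]; linarith [hδ.2])
  have hε0 : 0 ≤ ε := by positivity
  have htail : P.real {xs | n * ε < Ψ xs - ∫ z, Ψ z ∂P} ≤ δ := by
    rcases hB0.eq_or_lt with hB | hB
    · have hz : (n * ((2 * B).toNNReal / 2) ^ 2 : NNReal) = 0 := by simp [← hB]
      rw [hz] at hsub
      have hae := hsub.ae_eq_zero_of_hasSubgaussianMGF_zero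
      have : P {xs | n * ε < Ψ xs - ∫ z, Ψ z ∂P} = 0 := by
        rw [← nonpos_iff_eq_zero, ← ae_iff.1 hae]
        refine measure_mono fun xs (hxs : n * ε < _) h => ?_
        simp only [Pi.zero_apply] at h
        rw [h] at hxs
        exact absurd hxs (not_lt.2 (by positivity))
      rw [measureReal_def, this]
      exact hδ.1.le
    · refine (measureReal_mono (fun xs (hxs : n * ε < _) => le_of_lt hxs)).trans
        ((hsub.measure_ge_le (by positivity : 0 ≤ n * ε)).trans ?_)
      have hexp : -(n * ε) ^ 2 / (2 * ((n * ((2 * B).toNNReal / 2) ^ 2 : NNReal) : ℝ)) =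
          -Real.log (2 / δ) := by
        push_cast
        rw [Real.coe_toNNReal _ (by positivity), hε, mul_pow, mul_pow,
          Real.sq_sqrt (by positivity)]
        field_simp
      rw [hexp, Real.exp_neg, Real.exp_log (div_pos two_pos hδ.1), inv_div]
      linarith [hδ.1]
  have hmeas : MeasurableSet {xs | n * ε < Ψ xs - ∫ z, Ψ z ∂P} :=
    measurableSet_lt measurable_const (hΨm.sub_const _)
  have hcompl : 1 - δ ≤ P.real {xs | n * ε < Ψ xs - ∫ z, Ψ z ∂P}ᶜ := by
    rw [probReal_compl_eq_one_sub hmeas]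
    linarith
  refine (ENNReal.ofReal_le_ofReal hcompl).trans ?_
  rw [ofReal_measureReal]
  refine measure_mono fun xs hxs k l hkl => ?_
  have h1 : Ψ xs - ∫ z, Ψ z ∂P ≤ n * ε := not_lt.1 hxs
  have h2 := le_ciSup (hbdd xs) (k, l)
  have h3 : ∑ i, (d (k, l) (xs i) - ∫ x, d (k, l) x ∂ν) =
      (∑ i, f l (xs i) - ∑ i, f k (xs i)) + n * (∫ x, f k x ∂ν - ∫ x, f l x ∂ν) := by
    simp only [hd]
    rw [integral_sub (hfi l) (hfi k)]
    simp only [Finset.sum_sub_distrib, Finset.sum_const, Finset.card_univ, Fintype.card_fin,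
      nsmul_eq_mul]
    ring
  rw [h3] at h2
  have h4 : n * (∫ x, f k x ∂ν - ∫ x, f l x ∂ν) ≤ 4 * A + n * ε := by
    simp only [hΨ] at h1 hmean
    linarith
  rw [div_add' _ _ _ hn0.ne', le_div_iff₀ hn0]
  linarith

theorem expect_integral_eq_integral_expect {Z S : Type*} [MeasurableSpace Z] [Fintype S]
    {P : Measure Z} {φ : S → Z → ℝ} (hφ : ∀ s, Integrable (φ s) P) :
    𝔼 s, ∫ z, φ s z ∂P = ∫ z, 𝔼 s, φ s z ∂P := by
  simp only [Fintype.expect_eq_sum_div_card]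
  rw [integral_div, integral_finsetSum _ fun s _ => hφ s]

/-- Vector contraction for the Rademacher complexities of a vector-valued class. -/
theorem expect_integral_iSup_le_sum_rademacherComplexity {K : ℕ}
    {G : Set (X → EuclideanSpace ℝ (Fin K))} (hGc : G.Countable) (hGne : G.Nonempty)
    (hGm : ∀ g ∈ G, Measurable g) {Cg : ℝ} (hGb : ∀ g ∈ G, ∀ x, ∀ y, |g x y| ≤ Cg)
    {f : G → X → ℝ} (hf : ∀ g, Measurable (f g)) {B : ℝ} (hB : ∀ g x, |f g x| ≤ B)
    {L : ℝ} (hL0 : 0 ≤ L)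
    (hL : ∀ (g g' : G) x, |f g x - f g' x| ≤ L * ‖(g : X → EuclideanSpace ℝ (Fin K)) x - g'.1 x‖) :
    (𝔼 σ : Fin n → Bool, ∫ xs, ⨆ g, ∑ i, boolSign (σ i) * f g (xs i)
        ∂(Measure.pi fun _ : Fin n => ν)) / n ≤
      √2 * L * ∑ y, rademacherComplexity ν n ((fun g x => g x y) '' G) := by
  have := hGc.to_subtype
  have := hGne.to_subtype
  set P := Measure.pi fun _ : Fin n => ν
  have hint : ∀ {a : G → X → ℝ} {D : ℝ}, (∀ g, Measurable (a g)) → (∀ g x, |a g x| ≤ D) →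
      ∀ σ : Fin n → Bool, Integrable (fun xs => ⨆ g, ∑ i, boolSign (σ i) * a g (xs i)) P :=
    fun ha hD σ => integrable_iSup_of_abs_le P (fun g => Finset.measurable_fun_sum _ fun i _ =>
      ((ha g).comp (measurable_pi_apply i)).const_mul _) fun g xs => abs_sum_fin_le fun i => by
        rw [abs_mul, abs_boolSign, one_mul]; exact hD g _
  have hexp : ∀ {a : G → X → ℝ} {D : ℝ}, (∀ g, Measurable (a g)) → (∀ g x, |a g x| ≤ D) →
      Integrable (fun xs => 𝔼 σ : Fin n → Bool, ⨆ g, ∑ i, boolSign (σ i) * a g (xs i)) P :=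
    fun ha hD => by
      simp only [Fintype.expect_eq_sum_div_card]
      exact (integrable_finsetSum _ fun σ _ => hint ha hD σ).div_const _
  have hgm : ∀ (y : Fin K) (g : G), Measurable fun x => g.1 x y := fun y g =>
    (measurable_pi_apply y).comp ((WithLp.measurable_ofLp 2 _).comp (hGm g g.2))
  have hgb : ∀ (y : Fin K) (g : G) x, |g.1 x y| ≤ Cg := fun y g x => hGb g g.2 x y
  simp only [rademacherComplexity_image_eq ν fun (g : X → EuclideanSpace ℝ (Fin K)) x => g x _]
  rw [← Finset.sum_div, ← mul_div_assoc, expect_integral_eq_integral_expect (hint hf hB),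
    ← integral_finsetSum _ fun y _ => hexp (hgm y) (hgb y), ← integral_const_mul]
  refine div_le_div_of_nonneg_right (integral_mono (hexp hf hB)
    ((integrable_finsetSum _ fun y _ => hexp (hgm y) (hgb y)).const_mul _) fun xs => ?_)
    (Nat.cast_nonneg n)
  refine expect_iSup_sum_boolSign_mul_le (fun i (g : G) => f g (xs i))
    (fun i g k => g.1 (xs i) k) hL0 (fun i => ⟨B, fun g => hB g _⟩)
    (fun i k => ⟨Cg, fun g => hgb k g _⟩) fun i g g' => ?_
  simpa [EuclideanSpace.norm_eq] using hL g g' (xs i)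

end UniformDeviation

theorem measurable_comp_of_lipschitz_on_box {X : Type*} [MeasurableSpace X] {K : ℕ}
    {g : X → EuclideanSpace ℝ (Fin K)} (hg : Measurable g) {C : ℝ} (hC : ∀ x y, |g x y| ≤ C)
    {φ : EuclideanSpace ℝ (Fin K) → ℝ} {L : ℝ}
    (hφ : ∀ u u' : EuclideanSpace ℝ (Fin K), (∀ y, |u y| ≤ C) → (∀ y, |u' y| ≤ C) →
      |φ u - φ u'| ≤ L * ‖u - u'‖) :
    Measurable fun x => φ (g x) := by
  have hlip : LipschitzOnWith L.toNNReal φ {u | ∀ y, |u y| ≤ C} :=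
    LipschitzOnWith.of_dist_le_mul fun u hu u' hu' => by
      rw [Real.dist_eq, dist_eq_norm]
      exact (hφ u u' hu hu').trans
        (mul_le_mul_of_nonneg_right (Real.le_coe_toNNReal L) (norm_nonneg _))
  exact hlip.continuousOn.domRestrict.measurable.comp (hg.subtype_mk (h := hC))

/-- **Estimation error bound for SC-Conf classification (Theorem 2).**
With probability at least `1 − δ` over an i.i.d. sample of size `n` from the single-class
conditional distribution `ν = p(x|y_s)`, every empirical risk minimizer `ĝ` of the SC-Conf
empirical risk satisfies, for every `g* ∈ G`,
`R(ĝ) − R(g*) ≤ (4√2 π L_ℓ / C_r) ∑_y Rad_n(G_y, ν) + (2 π C_ℓ / C_r) √(log(2/δ)/(2n))`. -/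
theorem sc_conf_estimation_error_bound
    {X : Type*} [MeasurableSpace X] (μ : Measure X) [IsProbabilityMeasure μ]
    {K : ℕ} (hK : 2 ≤ K) (r : Fin K → X → ℝ)
    (hrm : ∀ y, Measurable (r y)) (hr0 : ∀ y x, 0 ≤ r y x)
    (hr1 : ∀ x, ∑ y, r y x = 1)
    (ys : Fin K) (Cr : ℝ) (hCr : Cr ∈ Set.Ioc (0 : ℝ) 1)
    (hrC : ∀ᵐ x ∂μ, Cr ≤ r ys x)
    (π : ℝ) (hπ : π = ∫ x, r ys x ∂μ) (hπ0 : 0 < π)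
    (ν : Measure X)
    (hν : ν = (ENNReal.ofReal π)⁻¹ • μ.withDensity fun x => ENNReal.ofReal (r ys x))
    (G : Set (X → EuclideanSpace ℝ (Fin K))) (hGc : G.Countable) (hGne : G.Nonempty)
    (hGm : ∀ g ∈ G, Measurable g)
    (Cg : ℝ) (hGb : ∀ g ∈ G, ∀ x, ∀ y, |g x y| ≤ Cg)
    (ℓ : EuclideanSpace ℝ (Fin K) → Fin K → ℝ) (Cℓ Lℓ : ℝ)
    (hℓb : ∀ u : EuclideanSpace ℝ (Fin K), (∀ y, |u y| ≤ Cg) →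
      ∀ y, 0 ≤ ℓ u y ∧ ℓ u y ≤ Cℓ)
    (hℓL : ∀ u u' : EuclideanSpace ℝ (Fin K), (∀ y, |u y| ≤ Cg) → (∀ y, |u' y| ≤ Cg) →
      ∀ y, |ℓ u y - ℓ u' y| ≤ Lℓ * ‖u - u'‖)
    (n : ℕ) (hn : 1 ≤ n) (δ : ℝ) (hδ : δ ∈ Set.Ioo (0 : ℝ) 1) :
    ENNReal.ofReal (1 - δ) ≤
      (Measure.pi fun _ : Fin n => ν)
        {xs | ∀ ghat ∈ G,
          (∀ g ∈ G,
              π / n * ∑ i, ∑ y, r y (xs i) / r ys (xs i) * ℓ (ghat (xs i)) y ≤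
                π / n * ∑ i, ∑ y, r y (xs i) / r ys (xs i) * ℓ (g (xs i)) y) →
          ∀ gstar ∈ G,
            (∫ x, ∑ y, r y x * ℓ (ghat x) y ∂μ) - ∫ x, ∑ y, r y x * ℓ (gstar x) y ∂μ ≤
              4 * Real.sqrt 2 * π * Lℓ / Cr *
                  ∑ y, rademacherComplexity ν n ((fun g x => g x y) '' G) +
                2 * π * Cℓ / Cr * Real.sqrt (Real.log (2 / δ) / (2 * n))} := by
  have hCr0 : 0 < Cr := hCr.1
  have hCount := hGc.to_subtype
  have hNe := hGne.to_subtype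
  have hn0 : (0 : ℝ) < n := by exact_mod_cast hn
  have hr_le : ∀ x, r ys x ≤ 1 := fun x => by
    rw [← hr1 x]
    exact Finset.single_le_sum (f := fun y => r y x) (fun y _ => hr0 y x) (Finset.mem_univ ys)
  have hri : Integrable (r ys) μ := Integrable.of_bound (hrm ys).aestronglyMeasurable 1
    (ae_of_all _ fun x => by rw [Real.norm_of_nonneg (hr0 ys x)]; exact hr_le x)
  have hprob : IsProbabilityMeasure ν := ⟨by
    rw [hν, Measure.smul_apply, withDensity_apply _ MeasurableSet.univ, Measure.restrict_univ,
      ← ofReal_integral_eq_lintegral_ofReal hri (ae_of_all _ (hr0 ys)), ← hπ, smul_eq_mul]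
    exact ENNReal.inv_mul_cancel (by simpa using hπ0) ENNReal.ofReal_ne_top⟩
  have hνC : ∀ᵐ x ∂ν, Cr ≤ r ys x := by
    rw [hν]
    exact (Measure.smul_absolutelyContinuous.trans
      (withDensity_absolutelyContinuous _ _)).ae_le hrC
  set f : G → X → ℝ := fun g x =>
    if Cr ≤ r ys x then π * ∑ y, r y x / r ys x * ℓ (g.1 x) y else 0 with hf
  have hfeq : ∀ g x, Cr ≤ r ys x → f g x = π * ∑ y, r y x / r ys x * ℓ (g.1 x) y :=
    fun g x hx => if_pos hx
  have hw0 : ∀ y x, 0 ≤ r y x / r ys x := fun y x => div_nonneg (hr0 y x) (hr0 ys x)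
  have hw : ∀ x, Cr ≤ r ys x → ∑ y, r y x / r ys x ≤ Cr⁻¹ := fun x hx => by
    rw [← Finset.sum_div, hr1, one_div]
    exact inv_anti₀ hCr0 hx
  have hfm : ∀ g, Measurable (f g) := fun g =>
    Measurable.ite (measurableSet_le measurable_const (hrm ys))
      ((Finset.measurable_fun_sum _ fun y _ => ((hrm y).div (hrm ys)).mul
        (measurable_comp_of_lipschitz_on_box (hGm g g.2) (hGb g g.2)
          fun u u' hu hu' => hℓL u u' hu hu' y)).const_mul π) measurable_const
  have hCℓ : 0 ≤ Cℓ := by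
    obtain ⟨x⟩ : Nonempty X := nonempty_of_isProbabilityMeasure μ
    obtain ⟨g, hg⟩ := hGne
    exact (hℓb (g x) (hGb g hg x) ys).1.trans (hℓb (g x) (hGb g hg x) ys).2
  have hf0 : ∀ g x, 0 ≤ f g x := fun g x => by
    simp only [hf]
    split_ifs
    · exact mul_nonneg hπ0.le (Finset.sum_nonneg fun y _ =>
        mul_nonneg (hw0 y x) (hℓb _ (hGb g g.2 x) y).1)
    · exact le_rfl
  have hfB : ∀ g x, f g x ≤ π * Cℓ / Cr := fun g x => by
    simp only [hf]
    split_ifs with hx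
    · rw [mul_div_assoc]
      refine mul_le_mul_of_nonneg_left ?_ hπ0.le
      calc ∑ y, r y x / r ys x * ℓ (g.1 x) y ≤ ∑ y, r y x / r ys x * Cℓ :=
            Finset.sum_le_sum fun y _ =>
              mul_le_mul_of_nonneg_left (hℓb _ (hGb g g.2 x) y).2 (hw0 y x)
        _ = (∑ y, r y x / r ys x) * Cℓ := (Finset.sum_mul _ _ _).symm
        _ ≤ Cr⁻¹ * Cℓ := mul_le_mul_of_nonneg_right (hw x hx) hCℓ
        _ = Cℓ / Cr := by rw [div_eq_inv_mul]
    · positivity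
  have hfL : ∀ L : ℝ, 0 ≤ L → Lℓ ≤ L → ∀ (g g' : G) x,
      |f g x - f g' x| ≤ π * L / Cr * ‖g.1 x - g'.1 x‖ := fun L hL0 hL g g' x => by
    simp only [hf]
    split_ifs with hx
    · rw [← mul_sub, ← Finset.sum_sub_distrib, abs_mul, abs_of_pos hπ0, mul_div_assoc, mul_assoc]
      refine mul_le_mul_of_nonneg_left ?_ hπ0.le
      calc |∑ y, (r y x / r ys x * ℓ (g.1 x) y - r y x / r ys x * ℓ (g'.1 x) y)|
          ≤ ∑ y, r y x / r ys x * (L * ‖g.1 x - g'.1 x‖) := by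
            refine (Finset.abs_sum_le_sum_abs _ _).trans (Finset.sum_le_sum fun y _ => ?_)
            rw [← mul_sub, abs_mul, abs_of_nonneg (hw0 y x)]
            refine mul_le_mul_of_nonneg_left ?_ (hw0 y x)
            exact (hℓL _ _ (hGb g g.2 x) (hGb g' g'.2 x) y).trans
              (mul_le_mul_of_nonneg_right hL (norm_nonneg _))
        _ = (∑ y, r y x / r ys x) * (L * ‖g.1 x - g'.1 x‖) := (Finset.sum_mul _ _ _).symm
        _ ≤ Cr⁻¹ * (L * ‖g.1 x - g'.1 x‖) :=
            mul_le_mul_of_nonneg_right (hw x hx) (by positivity)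
        _ = L / Cr * ‖g.1 x - g'.1 x‖ := by rw [div_eq_inv_mul, mul_assoc]
    · rw [sub_self, abs_zero]; positivity
  have hrisk : ∀ g : G, ∫ x, f g x ∂ν = ∫ x, ∑ y, r y x * ℓ (g.1 x) y ∂μ := fun g => by
    rw [hν, integral_smul_measure, integral_withDensity_eq_integral_toReal_smul
      (hrm ys).ennreal_ofReal (ae_of_all _ fun x => ENNReal.ofReal_lt_top), ← integral_smul]
    refine integral_congr_ae ?_
    filter_upwards [hrC] with x hx
    have hx0 : r ys x ≠ 0 := (hCr0.trans_le hx).ne'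
    rw [hfeq g x hx, ENNReal.toReal_inv, ENNReal.toReal_ofReal hπ0.le,
      ENNReal.toReal_ofReal (hr0 ys x)]
    simp only [smul_eq_mul, Finset.mul_sum]
    refine Finset.sum_congr rfl fun y _ => ?_
    field_simp
  have hrad : (𝔼 σ : Fin n → Bool, ∫ xs, ⨆ g, ∑ i, boolSign (σ i) * f g (xs i)
      ∂(Measure.pi fun _ : Fin n => ν)) / n ≤
        √2 * (π * Lℓ / Cr) * ∑ y, rademacherComplexity ν n ((fun g x => g x y) '' G) := by
    have hcontr := fun L hL0 hL => expect_integral_iSup_le_sum_rademacherComplexity ν (n := n)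
      hGc hGne hGm hGb hfm (fun g x => by rw [abs_of_nonneg (hf0 g x)]; exact hfB g x)
      (div_nonneg (mul_nonneg hπ0.le hL0) hCr0.le) (hfL L hL0 hL)
    rcases le_or_gt 0 Lℓ with hL | hL
    · exact hcontr Lℓ hL le_rfl
    · have hzero : ∀ g ∈ G, ∀ x, g x = 0 := fun g hg x => by
        have h1 := (abs_nonneg _).trans (hℓL (g x) (-g x) (hGb g hg x)
          (fun y => by simpa using hGb g hg x y) ys)
        have h2 : ‖g x - -g x‖ ≤ 0 := by
          by_contra! h
          exact absurd h1 (not_le.2 (mul_neg_of_neg_of_pos hL h))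
        have h3 := norm_le_zero_iff.1 h2
        rwa [sub_neg_eq_add, ← two_smul ℝ, smul_eq_zero_iff_right two_ne_zero] at h3
      have hR : ∀ y, rademacherComplexity ν n ((fun g x => g x y) '' G) = 0 := fun y => by
        rw [rademacherComplexity_image_eq ν fun (g : X → EuclideanSpace ℝ (Fin K)) x => g x y]
        have : ∀ (g : G) x, g.1 x y = 0 := fun g x => by rw [hzero g g.2 x]; rfl
        simp [this]
      have h0 := hcontr 0 le_rfl hL.le
      simp only [hR] at h0 ⊢
      simpa using h0
  refine (le_measure_integral_sub_integral_le ν hfm hf0 hfB hn hδ).trans (measure_mono_ae ?_)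
  have hgood : ∀ᵐ xs ∂(Measure.pi fun _ : Fin n => ν), ∀ i, Cr ≤ r ys (xs i) :=
    ae_all_iff.2 fun i =>
      (measurePreserving_eval (fun _ : Fin n => ν) i).quasiMeasurePreserving.ae hνC
  filter_upwards [hgood] with xs hxs hdev ghat hghat hmin gstar hgstar
  have hsum : ∀ g : G, ∑ i, f g (xs i) =
      π * ∑ i, ∑ y, r y (xs i) / r ys (xs i) * ℓ (g.1 (xs i)) y := fun g => by
    rw [Finset.mul_sum]
    exact Finset.sum_congr rfl fun i _ => hfeq g _ (hxs i)
  have hle := hdev ⟨ghat, hghat⟩ ⟨gstar, hgstar⟩ (by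
    rw [hsum, hsum]
    exact mul_le_mul_of_nonneg_left
      (le_of_mul_le_mul_left (hmin gstar hgstar) (div_pos hπ0 hn0)) hπ0.le)
  rw [hrisk, hrisk] at hle
  refine hle.trans ?_
  have e1 : 4 * √2 * π * Lℓ / Cr * ∑ y, rademacherComplexity ν n ((fun g x => g x y) '' G) =
      4 * (√2 * (π * Lℓ / Cr) * ∑ y, rademacherComplexity ν n ((fun g x => g x y) '' G)) := by
    ring
  have e2 : 2 * π * Cℓ / Cr = 2 * (π * Cℓ / Cr) := by ring
  rw [e1, e2, mul_div_assoc]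
  exact add_le_add (mul_le_mul_of_nonneg_left hrad (by norm_num)) le_rfl
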